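/- Let r ≥ 1, b ≥ 0 and t ≥ 0 be integers, and let G be the graph on the vertex set {u_1,...,u_r, v_1,...,v_r, x, y_1,...,y_b, z_1,...,z_t} with edge set {{u_i,v_i} : i ∈ [r]} ∪ {{x,v_i} : i ∈ [r]} ∪ {{x,y_i} : i ∈ [b]} ∪ {{v_r,z_i} : i ∈ [t]}. Then G is a tree, the induced matching number of G equals r, and every minimal vertex cover of G has cardinality at most max(r + t + 1, 2r + b + t + 1 − (r + t + 1)) where in fact τ_max(G) = r + t + 1 provided r + t + 1 ≥ ⌈(2r + b + t + 1)/2⌉. -/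

import Mathlib

variable {V : Type*}

/-- `M` is a matching of `G`: a finite collection of pairwise disjoint edges of `G`. -/
def IsMatchingFinset (G : SimpleGraph V) (M : Finset (Sym2 V)) : Prop :=
  (∀ e ∈ M, e ∈ G.edgeSet) ∧ ∀ e ∈ M, ∀ f ∈ M, e ≠ f → ∀ v : V, v ∈ e → v ∉ f

/-- The matching number `mat(G)`: the maximum size of a matching of `G`. -/
noncomputable def matchingNumber (G : SimpleGraph V) : ℕ :=
  sSup { m | ∃ M : Finset (Sym2 V), IsMatchingFinset G M ∧ M.card = m }

/-- `M` is an induced matching of `G`: a matching such that the induced subgraph of `G`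
on the union of the edges of `M` has exactly the edges of `M`. -/
def IsInducedMatchingFinset (G : SimpleGraph V) (M : Finset (Sym2 V)) : Prop :=
  IsMatchingFinset G M ∧ ∀ e ∈ G.edgeSet, (∀ v ∈ e, ∃ f ∈ M, v ∈ f) → e ∈ M

/-- The induced matching number `indm(G)`: the maximum size of an induced matching of `G`. -/
noncomputable def inducedMatchingNumber (G : SimpleGraph V) : ℕ :=
  sSup { m | ∃ M : Finset (Sym2 V), IsInducedMatchingFinset G M ∧ M.card = m }

/-- `C` is a vertex cover of `G`: every edge of `G` contains a vertex of `C`. -/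
def IsVertexCover (G : SimpleGraph V) (C : Finset V) : Prop :=
  ∀ e ∈ G.edgeSet, ∃ v ∈ C, v ∈ e

/-- `C` is a minimal vertex cover of `G`: no proper subset of `C` is a vertex cover. -/
def IsMinimalVertexCover (G : SimpleGraph V) (C : Finset V) : Prop :=
  IsVertexCover G C ∧ ∀ D : Finset V, D ⊂ C → ¬ IsVertexCover G D

/-- `τ_max(G)`: the maximum cardinality of a minimal vertex cover of `G`. -/
noncomputable def tauMax (G : SimpleGraph V) : ℕ :=
  sSup { m | ∃ C : Finset V, IsMinimalVertexCover G C ∧ C.card = m }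

/-- `(A, B)` is a bipartition of `G`: the vertex set is partitioned into the two
independent sets `A` and `B`. -/
def IsBipartition (G : SimpleGraph V) (A B : Set V) : Prop :=
  (∀ v, v ∈ A ∨ v ∈ B) ∧ (∀ v, ¬(v ∈ A ∧ v ∈ B)) ∧
    (∀ u v, G.Adj u v → ¬(u ∈ A ∧ v ∈ A)) ∧ (∀ u v, G.Adj u v → ¬(u ∈ B ∧ v ∈ B))

/-- `G` is bipartite: its vertex set can be partitioned into two independent sets
(equivalently, `G` has no odd cycles). -/
def IsBipartite (G : SimpleGraph V) : Prop :=
  ∃ A B : Set V, IsBipartition G A B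

/-- `G` is complete bipartite: for some bipartition `(A, B)` of the vertex set, the edges
of `G` are exactly the pairs `{a, b}` with `a ∈ A` and `b ∈ B`. -/
def IsCompleteBipartite (G : SimpleGraph V) : Prop :=
  ∃ A B : Set V, (∀ v, v ∈ A ∨ v ∈ B) ∧ (∀ v, ¬(v ∈ A ∧ v ∈ B)) ∧
    ∀ u v, G.Adj u v ↔ ((u ∈ A ∧ v ∈ B) ∨ (u ∈ B ∧ v ∈ A))

/-- `G` is chordal: it has no induced cycles of length greater than three, i.e. every
cycle of length at least `4` (an injective cyclic sequence of adjacent vertices) has a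
chord (an edge between two vertices that are not consecutive on the cycle). -/
def IsChordal (G : SimpleGraph V) : Prop :=
  ∀ m : ℕ, 4 ≤ m → ∀ f : ZMod m → V, Function.Injective f →
    (∀ i, G.Adj (f i) (f (i + 1))) →
    ∃ i j : ZMod m, i ≠ j ∧ i + 1 ≠ j ∧ j + 1 ≠ i ∧ G.Adj (f i) (f j)

/-- The co-chordal cover number `cochord(G)`: the minimum number of co-chordal subgraphs
of `G` needed to cover the edge set of `G`.  (A graph is co-chordal if its complement is
chordal; note that a subgraph is co-chordal in this sense iff the complement of the
subgraph on its own vertex set is chordal, since the extra vertices are universal in the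
complement and universal vertices do not affect chordality.) -/
noncomputable def cochordalCoverNumber (G : SimpleGraph V) : ℕ :=
  sInf { r | ∃ H : Fin r → SimpleGraph V, (∀ i, H i ≤ G) ∧ (∀ i, IsChordal (H i)ᶜ) ∧
    ∀ e ∈ G.edgeSet, ∃ i, e ∈ (H i).edgeSet }

/-- The adjacency relation of the tree, with vertices identified with natural numbers. -/
def TreeRel (r b p q : ℕ) : Prop :=
  (p < r ∧ q = r + p) ∨ (p = 2 * r ∧ r ≤ q ∧ q < 2 * r) ∨
    (p = 2 * r ∧ 2 * r < q ∧ q ≤ 2 * r + b) ∨ (p = 2 * r - 1 ∧ 2 * r + b < q)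

/-- In a finite graph in which every vertex other than `x` has a parent, the parents
lead to `x`, and every edge joins a vertex to its parent, the graph is a tree. -/
theorem isTree_of_parent {V : Type*} [Finite V] (G : SimpleGraph V) (x : V) (p : V → V)
    (hreach : ∀ v, G.Reachable v x)
    (hadj : ∀ u v, G.Adj u v → (u ≠ x ∧ p u = v) ∨ (v ≠ x ∧ p v = u)) : G.IsTree := by
  classical
  have hconn : G.Connected :=
    { preconnected := fun u v => (hreach u).trans (hreach v).symm
      nonempty := ⟨x⟩ }
  rw [SimpleGraph.isTree_iff_connected_and_card]
  refine ⟨hconn, le_antisymm ?_ hconn.card_vert_le_card_edgeSet_add_one⟩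
  have hsub : G.edgeSet ⊆ (fun v => s(v, p v)) '' {x}ᶜ := by
    intro e he
    induction e with
    | h u v =>
      rcases hadj u v he with ⟨h, rfl⟩ | ⟨h, rfl⟩
      · exact ⟨u, h, rfl⟩
      · exact ⟨v, h, Sym2.eq_swap⟩
  have h₁ := Set.ncard_le_ncard hsub (Set.toFinite _)
  have h₂ := Set.ncard_image_le (f := fun v => s(v, p v)) (Set.toFinite ({x}ᶜ : Set V))
  have h₃ := Set.ncard_add_ncard_compl ({x} : Set V)
  rw [Set.ncard_singleton] at h₃
  rw [Nat.card_coe_set_eq]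
  omega

theorem IsVertexCover.mem_or_mem {V : Type*} {G : SimpleGraph V} {C : Finset V}
    (hC : IsVertexCover G C) {u v : V} (h : G.Adj u v) : u ∈ C ∨ v ∈ C := by
  obtain ⟨w, hw, hwe⟩ := hC s(u, v) h
  rcases Sym2.mem_iff.1 hwe with rfl | rfl
  · exact Or.inl hw
  · exact Or.inr hw

theorem isVertexCover_of_adj {V : Type*} {G : SimpleGraph V} {C : Finset V}
    (h : ∀ u v, G.Adj u v → u ∈ C ∨ v ∈ C) : IsVertexCover G C := by
  intro e he
  induction e with
  | h u v =>
    rcases h u v he with h | h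
    · exact ⟨u, h, Sym2.mem_mk_left u v⟩
    · exact ⟨v, h, Sym2.mem_mk_right u v⟩

/-- Every vertex of a minimal vertex cover has a neighbour outside the cover. -/
theorem IsMinimalVertexCover.exists_adj_notMem {V : Type*} {G : SimpleGraph V} {C : Finset V}
    (hC : IsMinimalVertexCover G C) {u : V} (hu : u ∈ C) : ∃ v, G.Adj u v ∧ v ∉ C := by
  classical
  by_contra! hno
  refine hC.2 (C.erase u) (Finset.erase_ssubset hu) (isVertexCover_of_adj fun a c hac => ?_)
  simp only [Finset.mem_erase]
  by_cases ha : a = u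
  · subst ha
    exact Or.inr ⟨hac.ne', hno c hac⟩
  · by_cases hc : c = u
    · subst hc
      exact Or.inl ⟨ha, hno a hac.symm⟩
    · simpa [ha, hc] using hC.1.mem_or_mem hac

theorem isMinimalVertexCover_of_exists_adj {V : Type*} {G : SimpleGraph V} {C : Finset V}
    (hC : IsVertexCover G C) (h : ∀ u ∈ C, ∃ v, G.Adj u v ∧ v ∉ C) :
    IsMinimalVertexCover G C := by
  refine ⟨hC, fun D hD hcov => ?_⟩
  obtain ⟨u, hu, huD⟩ := Finset.exists_of_ssubset hD
  obtain ⟨v, huv, hv⟩ := h u hu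
  rcases hcov.mem_or_mem huv with h | h
  · exact huD h
  · exact hv (hD.1 h)

section Tree

variable {r b t : ℕ} {G : SimpleGraph (Fin (2 * r + b + t + 1))}

theorem treeRel_isTree (hr : 1 ≤ r)
    (hG : ∀ p q, G.Adj p q ↔ TreeRel r b p q ∨ TreeRel r b q p) : G.IsTree := by
  have hv : ∀ v : Fin (2 * r + b + t + 1), r ≤ v.val → v.val ≤ 2 * r + b →
      G.Reachable v ⟨2 * r, by omega⟩ := by
    intro v h₁ h₂
    by_cases h : v.val = 2 * r
    · rw [show v = ⟨2 * r, by omega⟩ from Fin.ext h]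
    · refine SimpleGraph.Adj.reachable ((hG _ _).2 ?_)
      simp only [TreeRel, true_and]
      omega
  refine isTree_of_parent G ⟨2 * r, by omega⟩ (fun v =>
    if h : v.val < r then ⟨r + v.val, by omega⟩
    else if v.val ≤ 2 * r + b then ⟨2 * r, by omega⟩ else ⟨2 * r - 1, by omega⟩) ?_ ?_
  · intro v
    by_cases h₁ : v.val < r
    · refine (SimpleGraph.Adj.reachable (v := ⟨r + v.val, by omega⟩) ((hG _ _).2 ?_)).trans
        (hv _ ?_ ?_) <;> simp only [TreeRel, and_true] <;> omega
    · by_cases h₂ : v.val ≤ 2 * r + b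
      · exact hv v (by omega) h₂
      · refine (SimpleGraph.Adj.reachable (v := ⟨2 * r - 1, by omega⟩) ((hG _ _).2 ?_)).trans
          (hv _ ?_ ?_) <;> simp only [TreeRel, true_and] <;> omega
  · intro u v huv
    have h := (hG _ _).1 huv
    simp only [TreeRel] at h
    simp only [Fin.ext_iff, ne_eq]
    split_ifs <;> simp only <;> omega

theorem treeRel_inducedMatching_card_le (hr : 1 ≤ r)
    (hG : ∀ p q, G.Adj p q ↔ TreeRel r b p q ∨ TreeRel r b q p)
    {M : Finset (Sym2 (Fin (2 * r + b + t + 1)))} (hM : IsInducedMatchingFinset G M) :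
    M.card ≤ r := by
  obtain ⟨⟨hedge, hdisj⟩, hind⟩ := hM
  have hcover : ∀ e ∈ M, ∃ v ∈ e, r ≤ v.val ∧ v.val ≤ 2 * r := by
    intro e he
    have h := hedge e he
    induction e with
    | h u v =>
      have h := (hG _ _).1 h
      simp only [TreeRel] at h
      by_cases hu : r ≤ u.val ∧ u.val ≤ 2 * r
      · exact ⟨u, Sym2.mem_mk_left u v, hu⟩
      · exact ⟨v, Sym2.mem_mk_right u v, by omega⟩
  choose! f hfe hf using hcover
  have hinj : Set.InjOn (fun e => (f e).val) M := by
    intro e he e' he' h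
    by_contra hne
    have h : f e = f e' := Fin.ext h
    exact hdisj e he e' he' hne _ (hfe e he) (h ▸ hfe e' he')
  by_cases hx : ∃ e ∈ M, (⟨2 * r, by omega⟩ : Fin (2 * r + b + t + 1)) ∈ e
  · obtain ⟨e, he, hxe⟩ := hx
    refine le_trans (Finset.card_le_one.2 ?_) hr
    have key : ∀ e' ∈ M, e' = e := by
      intro e' he'
      by_contra hne
      have hfx : (f e').val ≠ 2 * r := fun h =>
        hdisj e he e' he' (Ne.symm hne) _ hxe
          ((Fin.ext h : f e' = ⟨2 * r, by omega⟩) ▸ hfe e' he')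
      have hb := hf e' he'
      have hadj : G.Adj ⟨2 * r, by omega⟩ (f e') := by
        rw [hG]
        simp only [TreeRel, true_and]
        omega
      have hmem : s(⟨2 * r, by omega⟩, f e') ∈ M := by
        refine hind _ hadj fun v hv => ?_
        rcases Sym2.mem_iff.1 hv with rfl | rfl
        · exact ⟨e, he, hxe⟩
        · exact ⟨e', he', hfe e' he'⟩
      by_cases h : s(⟨2 * r, by omega⟩, f e') = e
      · exact hdisj e he e' he' (Ne.symm hne) (f e') (h ▸ Sym2.mem_mk_right _ _) (hfe e' he')
      · exact hdisj _ hmem e he h _ (Sym2.mem_mk_left _ _) hxe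
    intro a ha c hc
    rw [key a ha, key c hc]
  · push Not at hx
    have hmaps : ∀ e ∈ M, (f e).val ∈ Finset.Ico r (2 * r) := by
      intro e he
      have hb := hf e he
      have hfx : (f e).val ≠ 2 * r := fun h =>
        hx e he ((Fin.ext h : f e = ⟨2 * r, by omega⟩) ▸ hfe e he)
      rw [Finset.mem_Ico]
      omega
    have h := Finset.card_le_card_of_injOn _ hmaps hinj
    rw [Nat.card_Ico] at h
    omega

theorem exists_treeRel_inducedMatching
    (hG : ∀ p q, G.Adj p q ↔ TreeRel r b p q ∨ TreeRel r b q p) :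
    ∃ M, IsInducedMatchingFinset G M ∧ M.card = r := by
  let f : Fin r → Sym2 (Fin (2 * r + b + t + 1)) := fun i =>
    s(⟨i.val, by omega⟩, ⟨r + i.val, by omega⟩)
  have hmem : ∀ i v, v ∈ f i ↔ v.val = i.val ∨ v.val = r + i.val := by
    intro i v
    simp only [f, Sym2.mem_iff, Fin.ext_iff]
  have hinj : Function.Injective f := by
    intro i j hij
    have h : (⟨i.val, by omega⟩ : Fin (2 * r + b + t + 1)) ∈ f j := hij ▸ (hmem i _).2 (Or.inl rfl)
    rw [hmem] at h
    simp only at h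
    ext
    omega
  refine ⟨Finset.univ.map ⟨f, hinj⟩, ⟨⟨?_, ?_⟩, ?_⟩, by simp⟩
  · simp only [Finset.mem_map, Finset.mem_univ, true_and, Function.Embedding.coeFn_mk,
      forall_exists_index, forall_apply_eq_imp_iff]
    intro i
    refine (hG _ _).2 ?_
    simp only [TreeRel, and_true]
    omega
  · simp only [Finset.mem_map, Finset.mem_univ, true_and, Function.Embedding.coeFn_mk,
      forall_exists_index, forall_apply_eq_imp_iff]
    intro i j hij v hi hj
    rw [hmem] at hi hj
    exact hij (congrArg f (Fin.ext (by omega)))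
  · intro e he hcov
    simp only [Finset.mem_map, Finset.mem_univ, true_and, Function.Embedding.coeFn_mk,
      exists_exists_eq_and] at hcov ⊢
    induction e with
    | h u v =>
      obtain ⟨i, hi⟩ := hcov u (Sym2.mem_mk_left u v)
      obtain ⟨j, hj⟩ := hcov v (Sym2.mem_mk_right u v)
      rw [hmem] at hi hj
      have h := (hG _ _).1 he
      simp only [TreeRel] at h
      refine ⟨i, ?_⟩
      simp only [f, Sym2.eq_iff, Fin.ext_iff]
      omega

theorem treeRel_minimalVertexCover_card_le (hr : 1 ≤ r)
    (hG : ∀ p q, G.Adj p q ↔ TreeRel r b p q ∨ TreeRel r b q p)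
    {C : Finset (Fin (2 * r + b + t + 1))} (hC : IsMinimalVertexCover G C) :
    C.card ≤ max (r + t + 1) (r + b) := by
  by_cases hx : (⟨2 * r, by omega⟩ : Fin (2 * r + b + t + 1)) ∈ C
  · refine le_max_of_le_left ?_
    have hmaps : ∀ p ∈ C, (if p.val < r then r + p.val else p.val) ∈
        Finset.Icc r (2 * r) ∪ Finset.Ico (2 * r + b + 1) (2 * r + b + t + 1) := by
      intro p hp
      obtain ⟨q, hpq, hq⟩ := hC.exists_adj_notMem hp
      have hqx : q.val ≠ 2 * r := fun h =>
        hq ((Fin.ext h : q = ⟨2 * r, by omega⟩) ▸ hx)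
      have h := (hG _ _).1 hpq
      simp only [TreeRel] at h
      simp only [Finset.mem_union, Finset.mem_Icc, Finset.mem_Ico]
      split_ifs <;> omega
    have hinj : Set.InjOn (fun p : Fin (2 * r + b + t + 1) =>
        if p.val < r then r + p.val else p.val) C := by
      have hexcl : ∀ p ∈ C, ∀ q ∈ C, p.val < r → q.val ≠ r + p.val := by
        intro p hp q hq hpr hqp
        obtain ⟨w, hpw, hw⟩ := hC.exists_adj_notMem hp
        have h := (hG _ _).1 hpw
        simp only [TreeRel] at h
        exact hw ((Fin.ext (by omega) : q = w) ▸ hq)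
      intro p hp q hq h
      have h₁ := hexcl p hp q hq
      have h₂ := hexcl q hq p hp
      ext
      simp only at h
      split_ifs at h <;> omega
    have h := (Finset.card_le_card_of_injOn _ hmaps hinj).trans (Finset.card_union_le _ _)
    rw [Nat.card_Icc, Nat.card_Ico] at h
    omega
  · refine le_max_of_le_right ?_
    have hv : ∀ q : Fin (2 * r + b + t + 1), r ≤ q.val → q.val < 2 * r → q ∈ C := by
      intro q h₁ h₂
      refine (hC.1.mem_or_mem (u := ⟨2 * r, by omega⟩) ((hG _ _).2 ?_)).resolve_left hx
      simp only [TreeRel, true_and]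
      omega
    have hmaps : ∀ p ∈ C, p.val ∈ Finset.Ico r (2 * r) ∪ Finset.Ioc (2 * r) (2 * r + b) := by
      intro p hp
      obtain ⟨q, hpq, hq⟩ := hC.exists_adj_notMem hp
      have hqv : ¬ (r ≤ q.val ∧ q.val < 2 * r) := fun h => hq (hv q h.1 h.2)
      have hpx : p.val ≠ 2 * r := fun h => hx ((Fin.ext h : p = ⟨2 * r, by omega⟩) ▸ hp)
      have h := (hG _ _).1 hpq
      simp only [TreeRel] at h
      simp only [Finset.mem_union, Finset.mem_Ico, Finset.mem_Ioc]
      omega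
    have h := (Finset.card_le_card_of_injOn _ hmaps Fin.val_injective.injOn).trans
      (Finset.card_union_le _ _)
    rw [Nat.card_Ico, Nat.card_Ioc] at h
    omega

theorem exists_treeRel_minimalVertexCover (hr : 1 ≤ r)
    (hG : ∀ p q, G.Adj p q ↔ TreeRel r b p q ∨ TreeRel r b q p) :
    ∃ C, IsMinimalVertexCover G C ∧ C.card = r + t + 1 := by
  let S : Finset ℕ :=
    Finset.range r ∪ ({2 * r} ∪ Finset.Ico (2 * r + b + 1) (2 * r + b + t + 1))
  have hS : ∀ n ∈ S, n < 2 * r + b + t + 1 := by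
    simp only [S, Finset.mem_union, Finset.mem_range, Finset.mem_singleton, Finset.mem_Ico]
    omega
  have hmem : ∀ p, p ∈ S.attachFin hS ↔
      p.val < r ∨ p.val = 2 * r ∨ 2 * r + b < p.val := by
    intro p
    simp only [Finset.mem_attachFin, S, Finset.mem_union, Finset.mem_range,
      Finset.mem_singleton, Finset.mem_Ico]
    omega
  refine ⟨S.attachFin hS, isMinimalVertexCover_of_exists_adj
    (isVertexCover_of_adj fun u v huv => ?_) fun u hu => ?_, ?_⟩
  · have h := (hG _ _).1 huv
    simp only [TreeRel] at h
    rw [hmem, hmem]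
    omega
  · rw [hmem] at hu
    by_cases hur : u.val < r
    · refine ⟨⟨r + u.val, by omega⟩, ?_⟩
      rw [hG, hmem]
      simp only [TreeRel, and_true]
      omega
    · refine ⟨⟨2 * r - 1, by omega⟩, ?_⟩
      rw [hG, hmem]
      simp only [TreeRel, true_and]
      omega
  · rw [Finset.card_attachFin, Finset.card_union_of_disjoint, Finset.card_union_of_disjoint]
    · simp only [Finset.card_range, Finset.card_singleton, Nat.card_Ico]
      omega
    all_goals
      rw [Finset.disjoint_left]
      simp only [Finset.mem_union, Finset.mem_range, Finset.mem_singleton, Finset.mem_Ico]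
      omega

end Tree

/-- Let `r ≥ 1`, `b, t ≥ 0`, and let `G` be the graph on the vertex set
`{u_1, …, u_r, v_1, …, v_r, x, y_1, …, y_b, z_1, …, z_t}` (encoded in `Fin (2r+b+t+1)` as
`u_i = i - 1`, `v_i = r + i - 1`, `x = 2r`, `y_i = 2r + i`, `z_i = 2r + b + i`) with edges
`{u_i, v_i}` for `i ∈ [r]`, `{x, v_i}` for `i ∈ [r]`, `{x, y_i}` for `i ∈ [b]` and
`{v_r, z_i}` for `i ∈ [t]`. Then `G` is a tree, `indm(G) = r`, every minimal vertex cover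
of `G` has cardinality at most `max(r+t+1, (2r+b+t+1) - (r+t+1))`, and in fact
`τ_max(G) = r+t+1` provided `r+t+1 ≥ ⌈(2r+b+t+1)/2⌉`. -/
theorem tree_construction_inducedMatching_tauMax (r b t : ℕ) (hr : 1 ≤ r)
    (G : SimpleGraph (Fin (2 * r + b + t + 1)))
    (hG : G = SimpleGraph.fromRel (fun p q : Fin (2 * r + b + t + 1) =>
      (∃ i, i < r ∧ (p : ℕ) = i ∧ (q : ℕ) = r + i) ∨
      (∃ i, i < r ∧ (p : ℕ) = 2 * r ∧ (q : ℕ) = r + i) ∨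
      (∃ i, i < b ∧ (p : ℕ) = 2 * r ∧ (q : ℕ) = 2 * r + 1 + i) ∨
      (∃ i, i < t ∧ (p : ℕ) = 2 * r - 1 ∧ (q : ℕ) = 2 * r + 1 + b + i))) :
    G.IsTree ∧ inducedMatchingNumber G = r ∧
      (∀ C : Finset (Fin (2 * r + b + t + 1)), IsMinimalVertexCover G C →
        C.card ≤ max (r + t + 1) (2 * r + b + t + 1 - (r + t + 1))) ∧
      ((2 * r + b + t + 1 + 1) / 2 ≤ r + t + 1 → tauMax G = r + t + 1) := by
  have hadj : ∀ p q, G.Adj p q ↔ TreeRel r b p q ∨ TreeRel r b q p := by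
    have hrel : ∀ p q : Fin (2 * r + b + t + 1),
        ((∃ i, i < r ∧ (p : ℕ) = i ∧ (q : ℕ) = r + i) ∨
        (∃ i, i < r ∧ (p : ℕ) = 2 * r ∧ (q : ℕ) = r + i) ∨
        (∃ i, i < b ∧ (p : ℕ) = 2 * r ∧ (q : ℕ) = 2 * r + 1 + i) ∨
        (∃ i, i < t ∧ (p : ℕ) = 2 * r - 1 ∧ (q : ℕ) = 2 * r + 1 + b + i)) ↔
        TreeRel r b p q := by
      intro p q
      refine or_congr ⟨?_, fun h => ⟨p, by omega⟩⟩ (or_congr ⟨?_, fun h => ⟨q - r, by omega⟩⟩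
        (or_congr ⟨?_, fun h => ⟨q - (2 * r + 1), by omega⟩⟩
          ⟨?_, fun h => ⟨q - (2 * r + 1 + b), by omega⟩⟩)) <;>
      · rintro ⟨i, hi⟩
        omega
    intro p q
    rw [hG, SimpleGraph.fromRel_adj, hrel, hrel, and_iff_right_iff_imp]
    rintro h rfl
    simp only [TreeRel] at h
    omega
  have hle := fun C (hC : IsMinimalVertexCover G C) =>
    treeRel_minimalVertexCover_card_le hr hadj hC
  refine ⟨treeRel_isTree hr hadj, IsGreatest.csSup_eq ⟨exists_treeRel_inducedMatching hadj, ?_⟩,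
    fun C hC => ?_, fun h =>
      IsGreatest.csSup_eq ⟨exists_treeRel_minimalVertexCover hr hadj, ?_⟩⟩
  · rintro _ ⟨M, hM, rfl⟩
    exact treeRel_inducedMatching_card_le hr hadj hM
  · have := hle C hC
    omega
  · rintro _ ⟨C, hC, rfl⟩
    have := hle C hC
    omega
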